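/- arXiv:2511.11904 — 4 statements merged into one kernel-verified Lean document; each statement's English description precedes it below -/
import Mathlib

section
/- The space H_2 of locally absolutely continuous functions u : (0,1] → ℝ with u(1) = 0 whose almost-everywhere derivative u' satisfies ∫_0^1 u'(r)² r dr < ∞ is a Hilbert space under the inner product ⟨u,v⟩ = 2π ∫_0^1 u'(r) v'(r) r dr; that is, this bilinear form is an inner product on H_2 and the induced norm is complete. -/
open MeasureTheory Set Filter RealInnerProductSpace

/-- Membership in the space `H₂`: `u : (0,1] → ℝ` is locally absolutely continuous on `(0,1]`
(equivalently, its a.e. pointwise derivative `deriv u` is integrable on every `[a,1] ⊆ (0,1]`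
and the fundamental theorem of calculus holds), `u 1 = 0`, and `∫_0^1 u'(r)² r dr < ∞`. -/
structure MemH2 (u : ℝ → ℝ) : Prop where
  locInt : ∀ a ∈ Ioo (0:ℝ) 1, IntegrableOn (deriv u) (Ioc a 1) volume
  ftc : ∀ x ∈ Ioc (0:ℝ) 1, u x = u 1 - ∫ s in Ioc x 1, deriv u s
  zero_at_one : u 1 = 0
  deriv_sq_int : IntegrableOn (fun r => (deriv u r)^2 * r) (Ioc (0:ℝ) 1) volume

/-- The `H₂` inner product `⟨u,v⟩₂ = 2π ∫_0^1 u'(r) v'(r) r dr`. -/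
noncomputable def inner2 (u v : ℝ → ℝ) : ℝ :=
  (2 * Real.pi) * ∫ r in Ioc (0:ℝ) 1, deriv u r * deriv v r * r

/-- The (normalized) Trudinger–Moser function `γ_t(r) = (1/(2π)) min{log(1/r), log(1/t)}`. -/
noncomputable def gammaTM (t r : ℝ) : ℝ :=
  (1 / (2 * Real.pi)) * min (Real.log (1/r)) (Real.log (1/t))

/-- The derivative of `u` weighted by `√r`; on `H₂` this is an isometry into `L²(0,1)`, up to the
factor `2π`. -/
noncomputable def weightedDeriv (u : ℝ → ℝ) (r : ℝ) : ℝ := deriv u r * √r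

theorem integrableOn_Ioc_of_memLp_mul_sqrt {g : ℝ → ℝ}
    (hg : MemLp (fun r => g r * √r) 2 (volume.restrict (Ioc (0:ℝ) 1))) {a : ℝ} (ha : 0 < a) :
    IntegrableOn g (Ioc a 1) volume := by
  have hsub : Ioc a 1 ⊆ Ioc (0:ℝ) 1 := Ioc_subset_Ioc_left ha.le
  have h1 : IntegrableOn (fun r => g r * √r) (Ioc a 1) volume :=
    IntegrableOn.mono_set (hg.integrable (by norm_num)) hsub
  have h2 : IntegrableOn (fun r => (√r)⁻¹ * (g r * √r)) (Ioc a 1) volume := by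
    refine Integrable.bdd_mul (c := (√a)⁻¹) h1
      (by fun_prop : Measurable fun r : ℝ => (√r)⁻¹).aestronglyMeasurable ?_
    filter_upwards [ae_restrict_mem measurableSet_Ioc] with r hr
    rw [Real.norm_of_nonneg (by positivity)]
    have : 0 < √a := Real.sqrt_pos.2 ha
    gcongr
    exact hr.1.le
  refine h2.congr_fun (fun r hr => ?_) measurableSet_Ioc
  have : √r ≠ 0 := (Real.sqrt_pos.2 (ha.trans hr.1)).ne'
  dsimp only
  field_simp

/-- Lebesgue differentiation for primitives of functions integrable away from `0`. -/
theorem ae_hasDerivAt_of_eq_neg_integral {u g : ℝ → ℝ}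
    (hg : ∀ a ∈ Ioo (0:ℝ) 1, IntegrableOn g (Ioc a 1) volume)
    (hu : ∀ x ∈ Ioc (0:ℝ) 1, u x = -∫ s in Ioc x 1, g s) :
    ∀ᵐ x ∂volume.restrict (Ioc (0:ℝ) 1), HasDerivAt u (g x) x := by
  have hpos (n : ℕ) : (0:ℝ) < 1 / (n + 2) := by positivity
  have hlt (n : ℕ) : (1:ℝ) / (n + 2) < 1 := by
    rw [div_lt_one (by positivity)]
    have : (0:ℝ) ≤ n := n.cast_nonneg
    linarith
  have key (n : ℕ) := IntervalIntegrable.ae_hasDerivAt_integral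
    ((intervalIntegrable_iff_integrableOn_Ioc_of_le (hlt n).le).2 (hg _ ⟨hpos n, hlt n⟩))
  rw [ae_restrict_iff' measurableSet_Ioc]
  filter_upwards [ae_all_iff.2 key, Measure.ae_ne volume (1:ℝ)] with x hx hx1 hx0
  obtain ⟨n, hn⟩ := exists_nat_one_div_lt hx0.1
  have hn' : 1 / ((n:ℝ) + 2) < x := by
    refine lt_of_le_of_lt ?_ hn
    gcongr
    norm_num
  have hd := hx n (by rw [uIcc_of_le (hlt n).le]; exact ⟨hn'.le, hx0.2⟩) 1 right_mem_uIcc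
  refine hd.congr_of_eventuallyEq ?_
  filter_upwards [Ioo_mem_nhds hx0.1 (lt_of_le_of_ne hx0.2 hx1)] with y hy
  rw [hu y ⟨hy.1, hy.2.le⟩, intervalIntegral.integral_of_ge hy.2.le]

theorem memH2_of_eq_neg_integral {u g : ℝ → ℝ}
    (hg : MemLp (fun r => g r * √r) 2 (volume.restrict (Ioc (0:ℝ) 1)))
    (hu : ∀ x ∈ Ioc (0:ℝ) 1, u x = -∫ s in Ioc x 1, g s) :
    MemH2 u ∧ deriv u =ᵐ[volume.restrict (Ioc (0:ℝ) 1)] g := by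
  have hint : ∀ a ∈ Ioo (0:ℝ) 1, IntegrableOn g (Ioc a 1) volume :=
    fun a ha => integrableOn_Ioc_of_memLp_mul_sqrt hg ha.1
  have hae : deriv u =ᵐ[volume.restrict (Ioc (0:ℝ) 1)] g := by
    filter_upwards [ae_hasDerivAt_of_eq_neg_integral hint hu] with x hx using hx.deriv
  have hae' (a : ℝ) (ha : 0 ≤ a) : deriv u =ᵐ[volume.restrict (Ioc a 1)] g :=
    ae_restrict_of_ae_restrict_of_subset (Ioc_subset_Ioc_left ha) hae
  have h1 : u 1 = 0 := by simp [hu 1 ⟨one_pos, le_rfl⟩]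
  refine ⟨⟨fun a ha => (hint a ha).congr (hae' a ha.1.le).symm, fun x hx => ?_, h1, ?_⟩, hae⟩
  · rw [h1, hu x hx, integral_congr_ae (hae' x hx.1.le), zero_sub]
  · refine Integrable.congr hg.integrable_sq ?_
    filter_upwards [hae, ae_restrict_mem measurableSet_Ioc] with r hr hr0
    rw [hr, mul_pow, Real.sq_sqrt hr0.1.le]

theorem exists_memH2_weightedDeriv_ae_eq {h : ℝ → ℝ}
    (hh : MemLp h 2 (volume.restrict (Ioc (0:ℝ) 1))) :
    ∃ u, MemH2 u ∧ weightedDeriv u =ᵐ[volume.restrict (Ioc (0:ℝ) 1)] h := by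
  have hsq : (fun r => h r / √r * √r) =ᵐ[volume.restrict (Ioc (0:ℝ) 1)] h := by
    filter_upwards [ae_restrict_mem measurableSet_Ioc] with r hr
    exact div_mul_cancel₀ _ (Real.sqrt_pos.2 hr.1).ne'
  obtain ⟨hu, hd⟩ := memH2_of_eq_neg_integral (u := fun x => -∫ s in Ioc x 1, h s / √s)
    ((memLp_congr_ae hsq).2 hh) (fun _ _ => rfl)
  refine ⟨_, hu, ?_⟩
  filter_upwards [hd, hsq] with r h1 h2
  rw [weightedDeriv, h1, h2]

theorem inner2_eq_integral_weightedDeriv (u v : ℝ → ℝ) :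
    inner2 u v =
      2 * Real.pi * ∫ r in Ioc (0:ℝ) 1, weightedDeriv u r * weightedDeriv v r := by
  unfold inner2
  congr 1
  refine setIntegral_congr_fun measurableSet_Ioc fun r hr => ?_
  rw [weightedDeriv, weightedDeriv, mul_mul_mul_comm, Real.mul_self_sqrt hr.1.le]

namespace MemH2

variable {u v : ℝ → ℝ}

theorem memLp_weightedDeriv (hu : MemH2 u) :
    MemLp (weightedDeriv u) 2 (volume.restrict (Ioc (0:ℝ) 1)) := by
  refine (memLp_two_iff_integrable_sq
    ((measurable_deriv u).mul (by fun_prop)).aestronglyMeasurable).2 ?_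
  refine Integrable.congr hu.deriv_sq_int ?_
  filter_upwards [ae_restrict_mem measurableSet_Ioc] with r hr
  simp [mul_pow, Real.sq_sqrt hr.1.le]

theorem eq_neg_integral (hu : MemH2 u) : ∀ x ∈ Ioc (0:ℝ) 1, u x = -∫ s in Ioc x 1, deriv u s :=
  fun x hx => by rw [hu.ftc x hx, hu.zero_at_one, zero_sub]

theorem integrableOn_deriv (hu : MemH2 u) {a : ℝ} (ha : 0 < a) :
    IntegrableOn (deriv u) (Ioc a 1) volume :=
  integrableOn_Ioc_of_memLp_mul_sqrt hu.memLp_weightedDeriv ha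

theorem add_aux (hu : MemH2 u) (hv : MemH2 v) :
    MemH2 (u + v) ∧ deriv (u + v) =ᵐ[volume.restrict (Ioc (0:ℝ) 1)] deriv u + deriv v := by
  refine memH2_of_eq_neg_integral ?_ fun x hx => ?_
  · simpa only [Pi.add_apply, add_mul] using! hu.memLp_weightedDeriv.add hv.memLp_weightedDeriv
  · simp only [Pi.add_apply]
    rw [integral_add (hu.integrableOn_deriv hx.1) (hv.integrableOn_deriv hx.1),
      hu.eq_neg_integral x hx, hv.eq_neg_integral x hx, neg_add]

theorem add (hu : MemH2 u) (hv : MemH2 v) : MemH2 (u + v) := (hu.add_aux hv).1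

theorem weightedDeriv_add (hu : MemH2 u) (hv : MemH2 v) :
    weightedDeriv (u + v) =ᵐ[volume.restrict (Ioc (0:ℝ) 1)]
      weightedDeriv u + weightedDeriv v := by
  filter_upwards [(hu.add_aux hv).2] with r hr
  simp only [weightedDeriv, hr, Pi.add_apply, add_mul]

end MemH2

theorem weightedDeriv_const_smul (c : ℝ) (u : ℝ → ℝ) :
    weightedDeriv (c • u) = c • weightedDeriv u := by
  ext r
  simp only [weightedDeriv, deriv_const_smul_field, Pi.smul_apply, smul_eq_mul, mul_assoc]

namespace MemH2

variable {u v : ℝ → ℝ}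

theorem const_smul (c : ℝ) (hu : MemH2 u) : MemH2 (c • u) := by
  refine (memH2_of_eq_neg_integral (g := c • deriv u) ?_ fun x hx => ?_).1
  · simpa only [Pi.smul_apply, smul_mul_assoc] using! hu.memLp_weightedDeriv.const_smul c
  · simp only [Pi.smul_apply]
    rw [integral_smul, hu.eq_neg_integral x hx, smul_neg]

theorem weightedDeriv_sub (hu : MemH2 u) (hv : MemH2 v) :
    weightedDeriv (u - v) =ᵐ[volume.restrict (Ioc (0:ℝ) 1)]
      weightedDeriv u - weightedDeriv v := by
  have h := hu.weightedDeriv_add (hv.const_smul (-1))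
  rw [weightedDeriv_const_smul] at h
  simpa only [neg_one_smul, ← sub_eq_add_neg] using h

theorem inner2_sub_self {h₁ h₂ : Lp ℝ 2 (volume.restrict (Ioc (0:ℝ) 1))}
    (hu : MemH2 u) (hv : MemH2 v)
    (h₁u : h₁ =ᵐ[volume.restrict (Ioc (0:ℝ) 1)] weightedDeriv u)
    (h₂v : h₂ =ᵐ[volume.restrict (Ioc (0:ℝ) 1)] weightedDeriv v) :
    inner2 (u - v) (u - v) = 2 * Real.pi * dist h₁ h₂ ^ 2 := by
  rw [inner2_eq_integral_weightedDeriv, dist_eq_norm, ← real_inner_self_eq_norm_sq, L2.inner_def]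
  congr 1
  refine integral_congr_ae ?_
  filter_upwards [hu.weightedDeriv_sub hv, Lp.coeFn_sub h₁ h₂, h₁u, h₂v] with r h1 h2 h3 h4
  simp only [h1, h2, h3, h4, Pi.sub_apply, inner_self_eq_norm_sq_to_K, Real.norm_eq_abs,
    RCLike.ofReal_real_eq_id, id_eq, abs_mul_abs_self, sq]

theorem inner2_add_left {w : ℝ → ℝ} (hu : MemH2 u) (hv : MemH2 v) (hw : MemH2 w) :
    inner2 (u + v) w = inner2 u w + inner2 v w := by
  simp only [inner2_eq_integral_weightedDeriv]
  rw [← mul_add]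
  congr 1
  refine Eq.trans ?_
    (integral_add (hu.memLp_weightedDeriv.integrable_mul hw.memLp_weightedDeriv)
      (hv.memLp_weightedDeriv.integrable_mul hw.memLp_weightedDeriv))
  refine integral_congr_ae ?_
  filter_upwards [hu.weightedDeriv_add hv] with r hr
  simp [hr, add_mul]

theorem eq_zero_of_inner2_self_eq_zero (hu : MemH2 u) (h : inner2 u u = 0) :
    ∀ x ∈ Ioc (0:ℝ) 1, u x = 0 := by
  rw [inner2_eq_integral_weightedDeriv, mul_eq_zero, or_iff_right (by positivity),
    integral_eq_zero_iff_of_nonneg (fun r => mul_self_nonneg _)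
      (hu.memLp_weightedDeriv.integrable_mul hu.memLp_weightedDeriv)] at h
  have hd : deriv u =ᵐ[volume.restrict (Ioc (0:ℝ) 1)] 0 := by
    filter_upwards [h, ae_restrict_mem measurableSet_Ioc] with r hr hr0
    have : √r ≠ 0 := (Real.sqrt_pos.2 hr0.1).ne'
    simpa [weightedDeriv, this] using hr
  intro x hx
  rw [hu.eq_neg_integral x hx, integral_congr_ae
    (ae_restrict_of_ae_restrict_of_subset (Ioc_subset_Ioc_left hx.1.le) hd)]
  simp

end MemH2

theorem inner2_comm (u v : ℝ → ℝ) : inner2 u v = inner2 v u := by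
  simp only [inner2, mul_comm (deriv u _)]

theorem inner2_const_smul_left (c : ℝ) (u v : ℝ → ℝ) :
    inner2 (c • u) v = c * inner2 u v := by
  simp only [inner2_eq_integral_weightedDeriv, weightedDeriv_const_smul, Pi.smul_apply,
    smul_eq_mul, mul_assoc c, integral_const_mul]
  ring

theorem inner2_self_nonneg (u : ℝ → ℝ) : 0 ≤ inner2 u u := by
  rw [inner2_eq_integral_weightedDeriv]
  exact mul_nonneg (by positivity) (integral_nonneg fun r => mul_self_nonneg _)

theorem exists_memH2_tendsto_of_cauchy {f : ℕ → ℝ → ℝ} (hf : ∀ k, MemH2 (f k))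
    (hc : ∀ ε > (0:ℝ), ∃ K, ∀ m ≥ K, ∀ k ≥ K, inner2 (f m - f k) (f m - f k) < ε) :
    ∃ u : ℝ → ℝ, MemH2 u ∧
      Tendsto (fun k => inner2 (f k - u) (f k - u)) atTop (nhds 0) := by
  let F (k : ℕ) : Lp ℝ 2 (volume.restrict (Ioc (0:ℝ) 1)) := (hf k).memLp_weightedDeriv.toLp
  have hF (k : ℕ) : F k =ᵐ[volume.restrict (Ioc (0:ℝ) 1)] weightedDeriv (f k) :=
    MemLp.coeFn_toLp _
  have hcauchy : CauchySeq F := by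
    refine Metric.cauchySeq_iff.2 fun ε hε => ?_
    obtain ⟨K, hK⟩ := hc (2 * Real.pi * ε ^ 2) (by positivity)
    refine ⟨K, fun m hm k hk => ?_⟩
    have h := hK m hm k hk
    rw [(hf m).inner2_sub_self (hf k) (hF m) (hF k)] at h
    exact lt_of_pow_lt_pow_left₀ 2 hε.le (lt_of_mul_lt_mul_left h (by positivity))
  obtain ⟨h, hh⟩ := cauchySeq_tendsto_of_complete hcauchy
  obtain ⟨u, hu, hud⟩ := exists_memH2_weightedDeriv_ae_eq (Lp.memLp h)
  refine ⟨u, hu, ?_⟩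
  simp only [fun k => (hf k).inner2_sub_self hu (hF k) hud.symm]
  simpa using ((tendsto_iff_dist_tendsto_zero.1 hh).pow 2).const_mul (2 * Real.pi)

/-- `H₂` is a Hilbert space under `⟨u,v⟩₂ = 2π ∫_0^1 u'(r)v'(r) r dr`:
it is a vector space of functions, the bilinear form is a symmetric, bilinear,
positive definite inner product on it, and the induced norm is complete. -/
theorem H2_is_Hilbert :
    -- `H₂` is closed under addition and scalar multiplication
    (∀ u v : ℝ → ℝ, MemH2 u → MemH2 v → MemH2 (u + v)) ∧
    (∀ (c : ℝ) (u : ℝ → ℝ), MemH2 u → MemH2 (c • u)) ∧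
    -- the form is symmetric
    (∀ u v : ℝ → ℝ, MemH2 u → MemH2 v → inner2 u v = inner2 v u) ∧
    -- the form is bilinear (additive and homogeneous in the first slot; symmetry gives
    -- the second slot)
    (∀ u v w : ℝ → ℝ, MemH2 u → MemH2 v → MemH2 w →
      inner2 (u + v) w = inner2 u w + inner2 v w) ∧
    (∀ (c : ℝ) (u v : ℝ → ℝ), MemH2 u → MemH2 v → inner2 (c • u) v = c * inner2 u v) ∧
    -- the form is positive definite
    (∀ u : ℝ → ℝ, MemH2 u → 0 ≤ inner2 u u) ∧
    (∀ u : ℝ → ℝ, MemH2 u → inner2 u u = 0 → ∀ x ∈ Ioc (0:ℝ) 1, u x = 0) ∧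
    -- the induced norm is complete: every Cauchy sequence in `H₂` converges in `H₂`
    (∀ f : ℕ → ℝ → ℝ, (∀ k, MemH2 (f k)) →
      (∀ ε > (0:ℝ), ∃ K, ∀ m ≥ K, ∀ k ≥ K, inner2 (f m - f k) (f m - f k) < ε) →
      ∃ u : ℝ → ℝ, MemH2 u ∧
        Tendsto (fun k => inner2 (f k - u) (f k - u)) atTop (nhds 0)) := by
  exact ⟨fun u v hu hv => hu.add hv, fun c u hu => hu.const_smul c,
    fun u v _ _ => inner2_comm u v, fun u v w hu hv hw => hu.inner2_add_left hv hw,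
    fun c u v _ _ => inner2_const_smul_left c u v, fun u _ => inner2_self_nonneg u,
    fun u hu h => hu.eq_zero_of_inner2_self_eq_zero h,
    fun f hf hc => exists_memH2_tendsto_of_cauchy hf hc⟩
end

section
/- For every t ∈ (0,1) and every u ∈ H_2, the reproducing identity 2π ∫_0^1 γ_t'(r) u'(r) r dr = u(t) holds; in other words, γ_t is the reproducing kernel for the evaluation functional E_t(u) = u(t) on H_2. -/
open MeasureTheory Set Filter RealInnerProductSpace

/-- Inside `(0,t)` the function `γ_t` is constant, so its derivative vanishes. -/
lemma deriv_gammaTM_of_lt {t r : ℝ} (hr : 0 < r) (hrt : r < t) :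
    deriv (gammaTM t) r = 0 := by
  have h : gammaTM t =ᶠ[nhds r] fun _ => (1 / (2 * Real.pi)) * Real.log (1 / t) := by
    filter_upwards [Ioo_mem_nhds hr hrt] with x hx
    rw [gammaTM, min_eq_right]
    exact Real.log_le_log (one_div_pos.2 (hr.trans hrt)) (one_div_le_one_div_of_le hx.1 hx.2.le)
  rw [h.deriv_eq, deriv_const]

/-- On `(t,∞)` the function `γ_t` is `-(1/(2π)) log r`, with derivative `-1/(2πr)`. -/
lemma deriv_gammaTM_of_gt {t r : ℝ} (ht : 0 < t) (htr : t < r) :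
    deriv (gammaTM t) r = -(1 / (2 * Real.pi * r)) := by
  have h : gammaTM t =ᶠ[nhds r] fun x => (1 / (2 * Real.pi)) * -Real.log x := by
    filter_upwards [Ioi_mem_nhds htr] with x hx
    rw [gammaTM, min_eq_left, one_div x, Real.log_inv]
    exact Real.log_le_log (one_div_pos.2 (ht.trans hx)) (one_div_le_one_div_of_le ht (le_of_lt hx))
  have hd := ((Real.hasDerivAt_log (ht.trans htr).ne').neg).const_mul (1 / (2 * Real.pi))
  rw [h.deriv_eq]
  refine hd.deriv.trans ?_
  have := (ht.trans htr).ne'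
  field_simp

/-- For every `t ∈ (0,1)` and every `u ∈ H₂`, the reproducing identity
`2π ∫_0^1 γ_t'(r) u'(r) r dr = u(t)` holds: `γ_t` is the reproducing kernel for the
evaluation functional `E_t(u) = u(t)` on `H₂`. -/
theorem gammaTM_reproducing (t : ℝ) (ht : t ∈ Ioo (0:ℝ) 1)
    (u : ℝ → ℝ) (hu : MemH2 u) :
    inner2 (gammaTM t) u = u t := by
  have hae : ∀ᵐ r ∂volume, r ∈ Ioc (0:ℝ) 1 → deriv (gammaTM t) r * deriv u r * r =
      (Ioc t 1).indicator (fun s => -(1 / (2 * Real.pi)) * deriv u s) r := by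
    filter_upwards [Measure.ae_ne volume t] with r hrt hr
    rcases lt_or_gt_of_ne hrt with h | h
    · rw [deriv_gammaTM_of_lt hr.1 h, indicator_of_notMem fun hm => lt_asymm h hm.1]
      ring
    · rw [deriv_gammaTM_of_gt ht.1 h, indicator_of_mem (show r ∈ Ioc t 1 from ⟨h, hr.2⟩)]
      have := hr.1.ne'
      field_simp
  rw [inner2, setIntegral_congr_ae measurableSet_Ioc hae, setIntegral_indicator measurableSet_Ioc,
    inter_eq_right.2 (Ioc_subset_Ioc_left ht.1.le), integral_const_mul,
    hu.ftc t ⟨ht.1, ht.2.le⟩, hu.zero_at_one]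
  field_simp
  ring
end

section
/- Let u ∈ H_2 and define v : B_2 \ {0} → ℝ by v(x) = u(|x|), where B_2 is the open unit ball of ℝ². Then v has a weak gradient on B_2 given by ∇v(x) = u'(|x|) · x/|x| for x ≠ 0; that is, for every compactly supported smooth function φ on B_2 and each i ∈ {1,2}, ∫_{B_2} v(x) ∂φ/∂x_i(x) dx = − ∫_{B_2} u'(|x|) (x_i/|x|) φ(x) dx. Consequently ∫_{B_2} |∇v(x)|² dx = 2π ∫_0^1 u'(r)² r dr. -/
open MeasureTheory Set Filter RealInnerProductSpace

/-- Euclidean space `ℝⁿ`. -/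
abbrev E (n : ℕ) := EuclideanSpace ℝ (Fin n)

/-- A compactly supported smooth function on the open unit ball `B_n`. -/
def IsTestFun (n : ℕ) (φ : E n → ℝ) : Prop :=
  ContDiff ℝ (⊤ : ℕ∞) φ ∧ HasCompactSupport φ ∧ tsupport φ ⊆ Metric.ball 0 1

/-- A radially symmetric function on `ℝⁿ`. -/
def IsRadial (n : ℕ) (φ : E n → ℝ) : Prop :=
  ∀ x y : E n, ‖x‖ = ‖y‖ → φ x = φ y

/-- `v` represents an element of `W^{1,2}_{0,r}(B_n)` (the completion of the compactly
supported smooth radially symmetric functions on the unit ball under `‖∇·‖_{L²}`)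
with weak gradient `G`: some sequence of compactly supported smooth radial functions
converges to `v` with gradients converging to `G` in `L²(B_n)`. -/
def MemW (n : ℕ) (v : E n → ℝ) (G : E n → E n) : Prop :=
  ∃ φ : ℕ → E n → ℝ,
    (∀ k, IsTestFun n (φ k) ∧ IsRadial n (φ k)) ∧
    (∀ k, IntegrableOn (fun x => ‖gradient (φ k) x - G x‖^2) (Metric.ball (0 : E n) 1) volume) ∧
    (∀ k, IntegrableOn (fun x => (φ k x - v x)^2) (Metric.ball (0 : E n) 1) volume) ∧
    Tendsto (fun k => ∫ x in Metric.ball (0 : E n) 1, ‖gradient (φ k) x - G x‖^2) atTop (nhds 0) ∧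
    Tendsto (fun k => ∫ x in Metric.ball (0 : E n) 1, (φ k x - v x)^2) atTop (nhds 0)

/-- The unit vector of the plane at angle `θ`. -/
noncomputable def unitVec (θ : ℝ) : E 2 :=
  Real.cos θ • EuclideanSpace.single 0 1 + Real.sin θ • EuclideanSpace.single 1 1

/-- The unit vector `unitVec θ` rotated by a right angle. -/
noncomputable def unitVecPerp (θ : ℝ) : E 2 :=
  (-Real.sin θ) • EuclideanSpace.single 0 1 + Real.cos θ • EuclideanSpace.single 1 1

@[fun_prop]
lemma contDiff_unitVec : ContDiff ℝ (⊤ : ℕ∞) unitVec := by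
  unfold unitVec; fun_prop

@[fun_prop]
lemma contDiff_unitVecPerp : ContDiff ℝ (⊤ : ℕ∞) unitVecPerp := by
  unfold unitVecPerp; fun_prop

lemma hasDerivAt_unitVec (θ : ℝ) : HasDerivAt unitVec (unitVecPerp θ) θ :=
  ((Real.hasDerivAt_cos θ).smul_const _).add ((Real.hasDerivAt_sin θ).smul_const _)

lemma hasDerivAt_unitVecPerp_apply (i : Fin 2) (θ : ℝ) :
    HasDerivAt (fun t => unitVecPerp t i) (-unitVec θ i) θ := by
  fin_cases i
  · simpa [unitVecPerp, unitVec] using (Real.hasDerivAt_sin θ).fun_neg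
  · simpa [unitVecPerp, unitVec] using Real.hasDerivAt_cos θ

lemma norm_unitVec (θ : ℝ) : ‖unitVec θ‖ = 1 := by
  simp [unitVec, EuclideanSpace.norm_eq, Fin.sum_univ_two]

lemma single_eq_unitVec_add_unitVecPerp (i : Fin 2) (θ : ℝ) :
    (EuclideanSpace.single i 1 : E 2)
      = unitVec θ i • unitVec θ + unitVecPerp θ i • unitVecPerp θ := by
  have h := Real.sin_sq_add_cos_sq θ
  ext j
  fin_cases i <;> fin_cases j <;> simp [unitVec, unitVecPerp] <;> linarith

/-- Integration in polar coordinates over the unit disc. -/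
lemma setIntegral_ball_eq_polar (f : E 2 → ℝ) :
    ∫ x in Metric.ball (0 : E 2) 1, f x
      = ∫ p in Ioc (0:ℝ) 1 ×ˢ Ioc (-Real.pi) Real.pi, p.1 * f (p.1 • unitVec p.2) := by
  have hpt (p : ℝ × ℝ) : Complex.orthonormalBasisOneI.repr (Complex.polarCoord.symm p)
      = p.1 • unitVec p.2 := by
    ext j
    have := congrFun (Complex.orthonormalBasisOneI_repr_apply (Complex.polarCoord.symm p)) j
    rw [this]
    fin_cases j <;> simp [unitVec, -Complex.ofReal_cos, -Complex.ofReal_sin]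
  rw [← integral_indicator Metric.isOpen_ball.measurableSet,
    ← Complex.orthonormalBasisOneI.measurePreserving_repr.integral_comp
      Complex.orthonormalBasisOneI.repr.toHomeomorph.measurableEmbedding,
    ← Complex.integral_comp_polarCoord_symm, polarCoord_target]
  simp_rw [hpt]
  have hae : (Ioc (0:ℝ) 1 ×ˢ Ioc (-Real.pi) Real.pi : Set (ℝ × ℝ))
      =ᵐ[volume] Ioo (0:ℝ) 1 ×ˢ Ioo (-Real.pi) Real.pi :=
    Measure.set_prod_ae_eq Ioo_ae_eq_Ioc.symm Ioo_ae_eq_Ioc.symm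
  rw [setIntegral_congr_set hae,
    ← integral_indicator (measurableSet_Ioi.prod measurableSet_Ioo),
    ← integral_indicator (measurableSet_Ioo.prod measurableSet_Ioo)]
  congr 1 with p
  have hn : ‖p.1 • unitVec p.2‖ = |p.1| := by
    rw [norm_smul, norm_unitVec, mul_one, Real.norm_eq_abs]
  by_cases h0 : 0 < p.1
  · by_cases h1 : p.1 < 1 <;> simp [indicator, hn, h0, abs_of_pos h0, h1]
  · simp [indicator, h0]

/-- Integration in polar coordinates for the product of a radial function and a continuous one. -/
lemma setIntegral_polar_mul {g : ℝ → ℝ} (hg : IntegrableOn (fun r => g r * r) (Ioc 0 1))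
    {k : ℝ × ℝ → ℝ} (hk : Continuous k) :
    ∫ p in Ioc (0:ℝ) 1 ×ˢ Ioc (-Real.pi) Real.pi, p.1 * (g p.1 * k p)
      = ∫ r in Ioc (0:ℝ) 1, g r * r * ∫ θ in (-Real.pi)..Real.pi, k (r, θ) := by
  obtain ⟨C, hC⟩ := (isCompact_Icc (a := ((0 : ℝ), -Real.pi)) (b := (1, Real.pi))
    ).exists_bound_of_continuousOn hk.continuousOn
  have hint : IntegrableOn (fun p : ℝ × ℝ => k p * (g p.1 * p.1 * 1))
      (Ioc (0:ℝ) 1 ×ˢ Ioc (-Real.pi) Real.pi) (volume.prod volume) := by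
    have h1 : IntegrableOn (fun _ => (1 : ℝ)) (Ioc (-Real.pi) Real.pi) volume := by simp
    have := Integrable.mul_prod hg h1
    rw [Measure.prod_restrict] at this
    refine this.bdd_mul (c := C) hk.aestronglyMeasurable ?_
    refine (ae_restrict_iff' (measurableSet_Ioc.prod measurableSet_Ioc)).2 (ae_of_all _ ?_)
    rintro ⟨r, θ⟩ ⟨hr, hθ⟩
    exact hC _ ⟨⟨hr.1.le, hθ.1.le⟩, ⟨hr.2, hθ.2⟩⟩
  calc _ = ∫ p in Ioc (0:ℝ) 1 ×ˢ Ioc (-Real.pi) Real.pi, k p * (g p.1 * p.1 * 1) := by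
        congr 1 with p; ring
    _ = _ := by
        rw [Measure.volume_eq_prod, setIntegral_prod _ hint]
        congr 1 with r
        rw [intervalIntegral.integral_of_le (by linarith [Real.pi_pos]), ← integral_const_mul]
        congr 1 with θ
        ring

/-- The divergence theorem on a disc, in polar coordinates. -/
lemma integral_fderiv_polar {φ : E 2 → ℝ} (hφ : ContDiff ℝ (⊤ : ℕ∞) φ) (i : Fin 2) (s : ℝ) :
    ∫ r in (0:ℝ)..s, r * ∫ θ in (-Real.pi)..Real.pi,
        fderiv ℝ φ (r • unitVec θ) (EuclideanSpace.single i 1)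
      = s * ∫ θ in (-Real.pi)..Real.pi, unitVec θ i * φ (s • unitVec θ) := by
  set f : ℝ × ℝ → ℝ := fun p => p.1 * (unitVec p.2 i * φ (p.1 • unitVec p.2)) with hf
  set g : ℝ × ℝ → ℝ := fun p => unitVecPerp p.2 i * φ (p.1 • unitVec p.2) with hg
  have hfc : ContDiff ℝ (⊤ : ℕ∞) f := by fun_prop
  have hgc : ContDiff ℝ (⊤ : ℕ∞) g := by fun_prop
  have hφd (x : E 2) : HasFDerivAt φ (fderiv ℝ φ x) x :=
    (hφ.differentiable (by simp) x).hasFDerivAt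
  have hfd (p : ℝ × ℝ) : HasFDerivAt f (fderiv ℝ f p) p :=
    (hfc.differentiable (by simp) p).hasFDerivAt
  have hgd (p : ℝ × ℝ) : HasFDerivAt g (fderiv ℝ g p) p :=
    (hgc.differentiable (by simp) p).hasFDerivAt
  have hdiv (r θ : ℝ) : fderiv ℝ f (r, θ) (1, 0) + fderiv ℝ g (r, θ) (0, 1)
      = r * fderiv ℝ φ (r • unitVec θ) (EuclideanSpace.single i 1) := by
    have h1 : HasDerivAt (fun t => f (t, θ)) (fderiv ℝ f (r, θ) (1, 0)) r :=
      (hfd (r, θ)).comp_hasDerivAt (f := fun t => (t, θ)) r ((hasDerivAt_id' r).prodMk (hasDerivAt_const r θ))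
    have h2 : HasDerivAt (fun t => g (r, t)) (fderiv ℝ g (r, θ) (0, 1)) θ :=
      (hgd (r, θ)).comp_hasDerivAt θ ((hasDerivAt_const θ r).prodMk (hasDerivAt_id' θ))
    have h3 : HasDerivAt (fun t => φ (t • unitVec θ))
        (fderiv ℝ φ (r • unitVec θ) (unitVec θ)) r := by
      have := (hφd (r • unitVec θ)).comp_hasDerivAt r ((hasDerivAt_id r).smul_const (unitVec θ))
      simpa [Function.comp_def] using this
    have h4 : HasDerivAt (fun t => φ (r • unitVec t))
        (fderiv ℝ φ (r • unitVec θ) (r • unitVecPerp θ)) θ :=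
      (hφd (r • unitVec θ)).comp_hasDerivAt θ ((hasDerivAt_unitVec θ).const_smul r)
    rw [h1.unique ((hasDerivAt_id r).mul (h3.const_mul (unitVec θ i))),
      h2.unique ((hasDerivAt_unitVecPerp_apply i θ).mul h4)]
    conv_rhs => rw [single_eq_unitVec_add_unitVecPerp i θ]
    simp only [map_add, map_smul, smul_eq_mul, id]
    ring
  have hcf : Continuous (fun p => fderiv ℝ f p (1, 0) + fderiv ℝ g p (0, 1)) :=
    ((hfc.continuous_fderiv (by simp)).clm_apply continuous_const).add
      ((hgc.continuous_fderiv (by simp)).clm_apply continuous_const)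
  have key := integral2_divergence_prod_of_hasFDerivAt_off_countable f g (fderiv ℝ f) (fderiv ℝ g)
    0 (-Real.pi) s Real.pi ∅ countable_empty hfc.continuous.continuousOn hgc.continuous.continuousOn
    (fun p _ => hfd p) (fun p _ => hgd p)
    (hcf.continuousOn.integrableOn_compact (isCompact_uIcc.prod isCompact_uIcc))
  simp only [hdiv, intervalIntegral.integral_const_mul] at key
  rw [key]
  simp [hf, hg, unitVec, unitVecPerp]

/-- Integration by parts on `(0,1]`, with the weight `r` controlling the singularity at `0`. -/
lemma integral_primitive_mul {h m : ℝ → ℝ} (hm : Continuous m) (hh : Measurable h)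
    (hint : IntegrableOn (fun r => h r * r) (Ioc 0 1)) :
    IntegrableOn (fun r => (∫ s in Ioc r 1, h s) * r) (Ioc 0 1) ∧
    ∫ r in Ioc (0:ℝ) 1, (∫ s in Ioc r 1, h s) * r * m r
      = ∫ s in Ioc (0:ℝ) 1, h s * ∫ r in (0:ℝ)..s, r * m r := by
  obtain ⟨C, hC⟩ := (isCompact_Icc (a := (0 : ℝ)) (b := 1)).exists_bound_of_continuousOn
    hm.continuousOn
  set μ := volume.restrict (Ioc (0:ℝ) 1)
  set T : Set (ℝ × ℝ) := {p | p.1 < p.2}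
  have hT : MeasurableSet T := measurableSet_lt measurable_fst measurable_snd
  set F : ℝ × ℝ → ℝ := T.indicator (fun p => h p.2 * p.1)
  have hFm : Measurable F := Measurable.indicator (by fun_prop) hT
  have hae : ∀ᵐ p ∂(μ.prod μ), p ∈ Ioc (0:ℝ) 1 ×ˢ Ioc (0:ℝ) 1 := by
    rw [Measure.prod_restrict]
    exact ae_restrict_mem (measurableSet_Ioc.prod measurableSet_Ioc)
  have hF : Integrable F (μ.prod μ) := by
    have h1 : Integrable (fun _ => (1 : ℝ)) μ := integrable_const 1
    refine (h1.mul_prod hint).mono hFm.aestronglyMeasurable ?_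
    filter_upwards [hae] with p hp
    by_cases hpT : p ∈ T
    · have h3 : p.1 < p.2 := hpT
      simp only [F, indicator_of_mem hpT, one_mul, norm_mul, Real.norm_eq_abs,
        abs_of_pos hp.1.1, abs_of_pos hp.2.1]
      gcongr
    · simp only [F, indicator_of_notMem hpT, norm_zero]
      positivity
  have hFr (r : ℝ) (hr : r ∈ Ioc (0:ℝ) 1) : ∫ s, F (r, s) ∂μ = (∫ s in Ioc r 1, h s) * r := by
    have : (fun s => F (r, s)) = (Ioi r).indicator (fun s => h s * r) := by
      ext s; simp [F, T, indicator]
    rw [this, setIntegral_indicator measurableSet_Ioi, integral_mul_const, Ioc_inter_Ioi,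
      sup_eq_right.2 hr.1.le]
  have hmF : Integrable (fun p : ℝ × ℝ => m p.1 * F p) (μ.prod μ) := by
    refine hF.bdd_mul (c := C) (by fun_prop) ?_
    filter_upwards [hae] with p hp
    exact hC _ ⟨hp.1.1.le, hp.1.2⟩
  refine ⟨hF.integral_prod_left.congr ?_, ?_⟩
  · filter_upwards [ae_restrict_mem measurableSet_Ioc] with r hr using hFr r hr
  · calc _ = ∫ r, ∫ s, m r * F (r, s) ∂μ ∂μ := by
          refine setIntegral_congr_fun measurableSet_Ioc fun r hr => ?_
          simp only [integral_const_mul, hFr r hr]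
          ring
      _ = ∫ s, ∫ r, m r * F (r, s) ∂μ ∂μ := integral_integral_swap hmF
      _ = _ := by
          refine setIntegral_congr_fun measurableSet_Ioc fun s hs => ?_
          have : (fun r => m r * F (r, s)) = (Iio s).indicator (fun r => h s * (r * m r)) := by
            ext r
            by_cases hrs : r < s <;> simp [F, T, indicator, hrs]
            ring
          simp only [this]
          rw [setIntegral_indicator measurableSet_Iio, integral_const_mul,
            intervalIntegral.integral_of_le hs.1.le]
          congr 1
          refine setIntegral_congr_set ?_
          have : Ioc (0:ℝ) 1 ∩ Iio s = Ioo 0 s := by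
            ext r; simp only [mem_inter_iff, mem_Ioc, mem_Iio, mem_Ioo]
            exact ⟨fun h => ⟨h.1.1, h.2⟩, fun h => ⟨⟨h.1, h.2.le.trans hs.2⟩, h.2⟩⟩
          rw [this]
          exact Ioo_ae_eq_Ioc

lemma MemH2.integrableOn_deriv_mul {u : ℝ → ℝ} (hu : MemH2 u) :
    IntegrableOn (fun r => deriv u r * r) (Ioc (0:ℝ) 1) := by
  have h1 : IntegrableOn (fun r : ℝ => r) (Ioc (0:ℝ) 1) :=
    continuous_id.integrableOn_Ioc
  refine Integrable.mono (hu.deriv_sq_int.add h1)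
    ((measurable_deriv u).mul measurable_id).aestronglyMeasurable ?_
  filter_upwards [ae_restrict_mem measurableSet_Ioc] with r hr
  have hr0 := hr.1
  simp only [Pi.add_apply, Real.norm_eq_abs]
  rw [abs_mul, abs_of_pos hr0, abs_of_nonneg (a := _ + _) (by positivity), ← sq_abs]
  nlinarith [mul_nonneg (sq_nonneg (|deriv u r| - 1)) hr0.le,
    mul_nonneg (abs_nonneg (deriv u r)) hr0.le]

lemma MemH2.eq_neg_integral_s6 {u : ℝ → ℝ} (hu : MemH2 u) {r : ℝ} (hr : r ∈ Ioc (0:ℝ) 1) :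
    u r = -∫ s in Ioc r 1, deriv u s := by
  rw [hu.ftc r hr, hu.zero_at_one, zero_sub]

/-- For `u ∈ H₂`, the function `v(x) = u(|x|)` on the unit ball `B₂ ⊆ ℝ²`
has weak gradient `∇v(x) = u'(|x|)·x/|x|`: for every compactly supported smooth `φ` on `B₂`
and each coordinate `i`, `∫_{B₂} v ∂φ/∂xᵢ dx = -∫_{B₂} u'(|x|)(xᵢ/|x|) φ dx`.
Consequently `∫_{B₂} |∇v|² dx = 2π ∫_0^1 u'(r)² r dr`. -/
theorem radial_extension_weak_gradient (u : ℝ → ℝ) (hu : MemH2 u) :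
    (∀ φ : E 2 → ℝ, IsTestFun 2 φ → ∀ i : Fin 2,
      ∫ x in Metric.ball (0 : E 2) 1, u ‖x‖ * fderiv ℝ φ x (EuclideanSpace.single i 1)
        = - ∫ x in Metric.ball (0 : E 2) 1, deriv u ‖x‖ * (x i / ‖x‖) * φ x) ∧
    ∫ x in Metric.ball (0 : E 2) 1, ‖(deriv u ‖x‖ / ‖x‖) • x‖^2
      = 2 * Real.pi * ∫ r in Ioc (0:ℝ) 1, (deriv u r)^2 * r := by
  have hmeas : MeasurableSet (Ioc (0:ℝ) 1 ×ˢ Ioc (-Real.pi) Real.pi) :=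
    measurableSet_Ioc.prod measurableSet_Ioc
  have hnorm {r : ℝ} (hr : 0 < r) (θ : ℝ) : ‖r • unitVec θ‖ = r := by
    rw [norm_smul, norm_unitVec, mul_one, Real.norm_of_nonneg hr.le]
  refine ⟨fun φ hφ i => ?_, ?_⟩
  · have hD : Continuous (fun p : ℝ × ℝ =>
        fderiv ℝ φ (p.1 • unitVec p.2) (EuclideanSpace.single i 1)) := by
      have h1 := hφ.1.continuous_fderiv (by simp)
      have h2 := contDiff_unitVec.continuous
      fun_prop
    have hK : Continuous (fun p : ℝ × ℝ => unitVec p.2 i * φ (p.1 • unitVec p.2)) := by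
      have h1 := hφ.1.continuous
      have h2 := contDiff_unitVec.continuous
      fun_prop
    obtain ⟨hV, hparts⟩ := integral_primitive_mul
      (m := fun r => ∫ θ in (-Real.pi)..Real.pi,
        fderiv ℝ φ (r • unitVec θ) (EuclideanSpace.single i 1))
      (intervalIntegral.continuous_parametric_intervalIntegral_of_continuous' hD _ _)
      (measurable_deriv u) hu.integrableOn_deriv_mul
    have hL : ∫ x in Metric.ball (0 : E 2) 1, u ‖x‖ * fderiv ℝ φ x (EuclideanSpace.single i 1)
        = -∫ p in Ioc (0:ℝ) 1 ×ˢ Ioc (-Real.pi) Real.pi, p.1 * ((∫ s in Ioc p.1 1, deriv u s) *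
          fderiv ℝ φ (p.1 • unitVec p.2) (EuclideanSpace.single i 1)) := by
      rw [setIntegral_ball_eq_polar, ← integral_neg]
      refine setIntegral_congr_fun hmeas fun p hp => ?_
      simp only [hnorm hp.1.1, hu.eq_neg_integral_s6 hp.1]
      ring
    have hR : ∫ x in Metric.ball (0 : E 2) 1, deriv u ‖x‖ * (x i / ‖x‖) * φ x
        = ∫ p in Ioc (0:ℝ) 1 ×ˢ Ioc (-Real.pi) Real.pi,
          p.1 * (deriv u p.1 * (unitVec p.2 i * φ (p.1 • unitVec p.2))) := by
      rw [setIntegral_ball_eq_polar]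
      refine setIntegral_congr_fun hmeas fun p hp => ?_
      have hp0 : p.1 ≠ 0 := hp.1.1.ne'
      simp only [hnorm hp.1.1, PiLp.smul_apply, smul_eq_mul]
      field_simp
    rw [hL, hR, setIntegral_polar_mul hV hD, setIntegral_polar_mul hu.integrableOn_deriv_mul hK,
      hparts]
    simp only [integral_fderiv_polar hφ.1, mul_assoc]
  · have h2 : ∫ x in Metric.ball (0 : E 2) 1, ‖(deriv u ‖x‖ / ‖x‖) • x‖^2
        = ∫ p in Ioc (0:ℝ) 1 ×ˢ Ioc (-Real.pi) Real.pi, p.1 * (deriv u p.1 ^ 2 * 1) := by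
      rw [setIntegral_ball_eq_polar]
      refine setIntegral_congr_fun hmeas fun p hp => ?_
      have hp0 : p.1 ≠ 0 := hp.1.1.ne'
      simp only [norm_smul (_ / _), hnorm hp.1.1, norm_div, Real.norm_of_nonneg hp.1.1.le]
      rw [div_mul_cancel₀ _ hp0, Real.norm_eq_abs, sq_abs, mul_one]
    rw [h2, setIntegral_polar_mul (k := fun _ => 1) hu.deriv_sq_int continuous_const,
      integral_mul_const]
    simp only [intervalIntegral.integral_const, smul_eq_mul]
    ring
end

section
/- For every t ∈ B_2 with t ≠ 0, the function k_t(x) := γ_{|t|}(|x|) belongs to W^{1,2}_{0,r}(B_2) and is the reproducing kernel for the point t: for every v ∈ W^{1,2}_{0,r}(B_2), if u ∈ H_2 is the locally absolutely continuous radial representative of v (so that v(x) = u(|x|) a.e.), then ∫_{B_2} ∇k_t(x) · ∇v(x) dx = u(|t|). -/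
open MeasureTheory Set Filter RealInnerProductSpace

/-- The gradient field of `x ↦ gammaTM s ‖x‖` on the plane. -/
noncomputable def kernelField (s : ℝ) (x : E 2) : E 2 :=
  (if s < ‖x‖ then -(1 / (2 * Real.pi * ‖x‖ ^ 2)) else 0) • x

lemma measurable_kernelField (s : ℝ) : Measurable (kernelField s) := by
  unfold kernelField
  have hs : MeasurableSet {x : E 2 | s < ‖x‖} := measurableSet_lt measurable_const measurable_norm
  have h : Measurable fun x : E 2 => -(1 / (2 * Real.pi * ‖x‖ ^ 2)) := by fun_prop
  exact (Measurable.ite hs h measurable_const).smul measurable_id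

lemma norm_kernelField_le {s : ℝ} (hs : 0 < s) (x : E 2) :
    ‖kernelField s x‖ ≤ 1 / (2 * Real.pi * s) := by
  unfold kernelField
  have hpi := Real.pi_pos
  split_ifs with h
  · have hx : 0 < ‖x‖ := hs.trans h
    rw [norm_smul, norm_neg, Real.norm_of_nonneg (by positivity)]
    have : 1 / (2 * Real.pi * ‖x‖ ^ 2) * ‖x‖ = 1 / (2 * Real.pi * ‖x‖) := by
      field_simp
    rw [this]
    gcongr
  · simp only [zero_smul, norm_zero]
    positivity

lemma ae_norm_ne (s : ℝ) : ∀ᵐ x : E 2, ‖x‖ ≠ s := by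
  have h := Measure.addHaar_sphere (volume : Measure (E 2)) 0 s
  rw [ae_iff]
  convert h using 2
  ext x
  simp

lemma deriv_gammaTM {s r : ℝ} (hs : 0 < s) (hr : 0 < r) (hrs : r ≠ s) :
    deriv (gammaTM s) r = if s < r then -(1 / (2 * Real.pi * r)) else 0 := by
  have hpi := Real.pi_pos
  split_ifs with h
  · have h1 : gammaTM s =ᶠ[nhds r] fun y => -(1 / (2 * Real.pi)) * Real.log y := by
      filter_upwards [lt_mem_nhds h] with y hy
      have hy0 : 0 < y := hs.trans hy
      have : Real.log s ≤ Real.log y := Real.log_le_log hs hy.le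
      simp only [gammaTM, one_div, Real.log_inv]
      rw [min_eq_left (by linarith)]
      ring
    rw [h1.deriv_eq]
    rw [((Real.hasDerivAt_log hr.ne').const_mul _).deriv]
    field_simp
  · have h' : r < s := lt_of_le_of_ne (not_lt.1 h) hrs
    have h1 : gammaTM s =ᶠ[nhds r] fun _ => (1 / (2 * Real.pi)) * Real.log (1 / s) := by
      filter_upwards [gt_mem_nhds h', lt_mem_nhds hr] with y hy hy0
      have : Real.log y ≤ Real.log s := Real.log_le_log hy0 hy.le
      simp only [gammaTM, one_div, Real.log_inv]
      rw [min_eq_right (by linarith)]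
    rw [h1.deriv_eq]
    simp

lemma deriv_gammaTM_smul_eq_kernelField {s : ℝ} (hs : 0 < s) {x : E 2} (hx : ‖x‖ ≠ s) :
    (deriv (gammaTM s) ‖x‖ / ‖x‖) • x = kernelField s x := by
  rcases eq_or_ne x 0 with rfl | h0
  · simp [kernelField]
  · have hx0 : 0 < ‖x‖ := norm_pos_iff.2 h0
    rw [deriv_gammaTM hs hx0 hx, kernelField]
    have hpi := Real.pi_pos
    congr 1
    split_ifs
    · field_simp
    · simp

lemma continuous_gradient {φ : E 2 → ℝ} (h : IsTestFun 2 φ) : Continuous (gradient φ) := by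
  have h1 : Continuous (fderiv ℝ φ) := h.1.continuous_fderiv (by simp)
  exact (InnerProductSpace.toDual ℝ (E 2)).symm.continuous.comp h1

lemma IsRadial.inner_gradient_self {φ : E 2 → ℝ} (hφ : Differentiable ℝ φ) (hr : IsRadial 2 φ)
    {e : E 2} (he : ‖e‖ = 1) (y : E 2) :
    ⟪gradient φ y, y⟫ = ‖y‖ * deriv (fun r : ℝ => φ (r • e)) ‖y‖ := by
  have key : ∀ z : E 2, HasDerivAt (fun c : ℝ => φ (c • z)) (⟪gradient φ z, z⟫) 1 := by
    intro z
    have h1 : HasDerivAt (fun c : ℝ => c • z) ((1 : ℝ) • z) 1 :=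
      (hasDerivAt_id (1 : ℝ)).smul_const z
    have h2 : HasFDerivAt φ (fderiv ℝ φ z) ((1 : ℝ) • z) := by
      rw [one_smul]; exact (hφ z).hasFDerivAt
    have := h2.comp_hasDerivAt (1 : ℝ) h1
    rw [inner_gradient_left]
    simpa [Function.comp_def] using this
  have h2 : HasDerivAt (fun c : ℝ => φ (c • y)) (‖y‖ * deriv (fun r : ℝ => φ (r • e)) ‖y‖) 1 := by
    have hd : DifferentiableAt ℝ (fun r : ℝ => φ (r • e)) (1 * ‖y‖) := by fun_prop
    have h3 : HasDerivAt (fun c : ℝ => c * ‖y‖) (1 * ‖y‖) 1 :=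
      (hasDerivAt_id (1 : ℝ)).mul_const _
    have h4 := HasDerivAt.comp (1 : ℝ) hd.hasDerivAt h3
    have h5 : (fun c : ℝ => φ (c • y)) = (fun r : ℝ => φ (r • e)) ∘ fun c => c * ‖y‖ := by
      ext c
      apply hr
      simp [norm_smul, he]
    rw [h5]
    rw [one_mul, mul_comm] at h4
    exact h4
  exact (key y).unique h2

lemma integral_kernelField_gradient {φ : E 2 → ℝ} (h : IsTestFun 2 φ) (hr : IsRadial 2 φ)
    {x : E 2} (hx : x ≠ 0) :
    ∫ y in Metric.ball (0 : E 2) 1, ⟪kernelField ‖x‖ y, gradient φ y⟫ = φ x := by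
  have hx0 : 0 < ‖x‖ := norm_pos_iff.2 hx
  have hpi := Real.pi_pos
  set e : E 2 := ‖x‖⁻¹ • x with he_def
  have he : ‖e‖ = 1 := by simp [he_def, norm_smul, hx0.ne']
  set Φ : ℝ → ℝ := fun r => φ (r • e) with hΦ
  have hΦs : ContDiff ℝ 1 Φ := (h.1.of_le (by simp)).comp (by fun_prop)
  have hΦc : HasCompactSupport Φ := by
    refine HasCompactSupport.intro (isCompact_Icc (a := (-1 : ℝ)) (b := 1)) fun r hrr => ?_
    refine image_eq_zero_of_notMem_tsupport (f := φ) (x := r • e) fun hmem => hrr ?_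
    have := h.2.2 hmem
    rw [mem_ball_zero_iff, norm_smul, he, mul_one, Real.norm_eq_abs, abs_lt] at this
    exact ⟨this.1.le, this.2.le⟩
  rw [setIntegral_eq_integral_of_forall_compl_eq_zero]
  · have h1 : ∀ y : E 2, ⟪kernelField ‖x‖ y, gradient φ y⟫ =
        (fun r : ℝ => if ‖x‖ < r then -(1 / (2 * Real.pi * r ^ 2)) * (r * deriv Φ r) else 0)
          ‖y‖ := by
      intro y
      have := IsRadial.inner_gradient_self (h.1.differentiable (by simp)) hr he y
      simp only [kernelField]
      rw [real_inner_smul_left, real_inner_comm, this]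
      split_ifs <;> simp [hΦ]
    rw [integral_congr_ae (Eventually.of_forall h1), integral_fun_norm_addHaar volume
      fun r : ℝ => if ‖x‖ < r then -(1 / (2 * Real.pi * r ^ 2)) * (r * deriv Φ r) else 0]
    have h2 : ∫ r in Ioi (0 : ℝ), r ^ (Module.finrank ℝ (E 2) - 1) •
        (if ‖x‖ < r then -(1 / (2 * Real.pi * r ^ 2)) * (r * deriv Φ r) else 0) =
        ∫ r in Ioi (0 : ℝ), (Ioi ‖x‖).indicator (fun r => -(1 / (2 * Real.pi)) * deriv Φ r) r := by
      refine setIntegral_congr_fun measurableSet_Ioi fun r hr0 => ?_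
      have hr0 : 0 < r := hr0
      simp only [finrank_euclideanSpace, Fintype.card_fin, indicator, mem_Ioi, smul_eq_mul]
      split_ifs
      · field_simp
        simp
      · simp
    rw [h2, setIntegral_indicator measurableSet_Ioi, inter_eq_right.2 (Ioi_subset_Ioi hx0.le),
      integral_const_mul, hΦc.integral_Ioi_deriv_eq hΦs]
    have h3 : Φ ‖x‖ = φ x := by
      simp [hΦ, he_def, smul_smul, hx0.ne']
    rw [h3]
    simp [Measure.real, EuclideanSpace.volume_ball_fin_two, hpi.le]
    field_simp
  · intro y hy
    have : gradient φ y = 0 := by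
      have h0 : fderiv ℝ φ y = 0 := by
        by_contra hne
        exact hy (h.2.2 (support_fderiv_subset ℝ hne))
      simp [gradient, h0]
    rw [this, inner_zero_right]

lemma exists_subseq_ae_tendsto_zero {α : Type*} [MeasurableSpace α] {μ : Measure α}
    {f : ℕ → α → ℝ} (hf : ∀ k, Integrable (f k) μ) (h0 : ∀ k x, 0 ≤ f k x)
    (h : Tendsto (fun k => ∫ x, f k x ∂μ) atTop (nhds 0)) :
    ∃ ns : ℕ → ℕ, StrictMono ns ∧
      ∀ᵐ x ∂μ, Tendsto (fun k => f (ns k) x) atTop (nhds 0) := by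
  have h1 : TendstoInMeasure μ f atTop (fun _ => (0 : ℝ)) := by
    refine tendstoInMeasure_of_tendsto_eLpNorm (p := 1) one_ne_zero
      (fun k => (hf k).aestronglyMeasurable) aestronglyMeasurable_const ?_
    have : ∀ k, eLpNorm (f k - fun _ => (0 : ℝ)) 1 μ = ENNReal.ofReal (∫ x, f k x ∂μ) := by
      intro k
      have hz : (f k - fun _ => (0 : ℝ)) = f k := by ext; simp
      rw [hz, eLpNorm_one_eq_lintegral_enorm, ofReal_integral_eq_lintegral_ofReal (hf k)
        (Eventually.of_forall (h0 k))]
      refine lintegral_congr fun x => ?_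
      rw [Real.enorm_of_nonneg (h0 k x)]
    simp_rw [this]
    simpa using ENNReal.tendsto_ofReal h
  exact h1.exists_seq_tendsto_ae

lemma tendsto_integral_of_tendsto_integral_sq {α : Type*} [MeasurableSpace α] {μ : Measure α}
    [IsFiniteMeasure μ] {f : ℕ → α → ℝ} (hm : ∀ k, AEStronglyMeasurable (f k) μ)
    (h0 : ∀ k x, 0 ≤ f k x) (hf : ∀ k, Integrable (fun x => f k x ^ 2) μ)
    (h : Tendsto (fun k => ∫ x, f k x ^ 2 ∂μ) atTop (nhds 0)) :
    Tendsto (fun k => ∫ x, f k x ∂μ) atTop (nhds 0) := by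
  have hL : ∀ k, MemLp (f k) (ENNReal.ofReal 2) μ := fun k => by
    simpa using (memLp_two_iff_integrable_sq (hm k)).2 (hf k)
  have hb : ∀ k, ∫ x, f k x ∂μ ≤
      (∫ x, f k x ^ 2 ∂μ) ^ (1 / 2 : ℝ) * (μ.real univ) ^ (1 / 2 : ℝ) := by
    intro k
    have := integral_mul_le_Lp_mul_Lq_of_nonneg (μ := μ) Real.HolderConjugate.two_two
      (Eventually.of_forall (h0 k)) (g := fun _ => (1 : ℝ))
      (Eventually.of_forall fun _ => zero_le_one)
      (hL k) (memLp_const _)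
    simpa using this
  refine squeeze_zero (fun k => integral_nonneg (h0 k)) hb ?_
  have := ((h.rpow_const (p := (1 / 2 : ℝ)) (Or.inr (by norm_num)))).mul_const
    ((μ.real univ) ^ (1 / 2 : ℝ))
  simpa using this

lemma MemH2.continuousOn {u : ℝ → ℝ} (hu : MemH2 u) : ContinuousOn u (Ioo 0 1) := by
  intro r hr
  have ha : r / 2 ∈ Ioo (0 : ℝ) 1 := ⟨half_pos hr.1, by linarith [hr.1, hr.2]⟩
  have har : r / 2 < r := half_lt_self hr.1
  have hint : IntegrableOn (deriv u) (uIcc (r / 2) 1) := by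
    rw [uIcc_of_le ha.2.le, integrableOn_Icc_iff_integrableOn_Ioc]
    exact hu.locInt _ ha
  have hc := intervalIntegral.continuousOn_primitive_interval_left hint
  rw [uIcc_of_le ha.2.le] at hc
  have hc' := (hc.continuousAt (Icc_mem_nhds har hr.2))
  refine ContinuousAt.continuousWithinAt ?_
  refine (continuousAt_const.sub hc' (x := r) (f := fun _ => u 1)).congr ?_
  filter_upwards [Ioo_mem_nhds hr.1 hr.2] with x hx
  rw [hu.ftc x ⟨hx.1, hx.2.le⟩, Pi.sub_apply, intervalIntegral.integral_of_le hx.2.le]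

lemma integrableOn_gradient {φ : E 2 → ℝ} (h : IsTestFun 2 φ) :
    IntegrableOn (gradient φ) (Metric.ball (0 : E 2) 1) :=
  ((continuous_gradient h).continuousOn.integrableOn_compact
    (isCompact_closedBall (0 : E 2) 1)).mono_set Metric.ball_subset_closedBall

instance : IsFiniteMeasure ((volume : Measure (E 2)).restrict (Metric.ball 0 1)) :=
  ⟨by simp⟩

lemma integrable_inner_kernelField {μ : Measure (E 2)} {G : E 2 → E 2} (hG : Integrable G μ)
    {s : ℝ} (hs : 0 < s) : Integrable (fun y => ⟪kernelField s y, G y⟫) μ := by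
  refine (hG.norm.const_mul (1 / (2 * Real.pi * s))).mono'
    ((measurable_kernelField s).aestronglyMeasurable.inner hG.aestronglyMeasurable) ?_
  refine Eventually.of_forall fun y => (norm_inner_le_norm _ _).trans ?_
  gcongr
  exact norm_kernelField_le hs y

lemma continuousAt_integral_inner_kernelField {μ : Measure (E 2)} (hμ : μ ≪ volume)
    {G : E 2 → E 2} (hG : Integrable G μ) {s : ℝ} (hs : 0 < s) :
    ContinuousAt (fun r => ∫ y, ⟪kernelField r y, G y⟫ ∂μ) s := by
  have hpi := Real.pi_pos
  refine continuousAt_of_dominated (bound := fun y => 1 / (2 * Real.pi * (s / 2)) * ‖G y‖) ?_ ?_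
    (hG.norm.const_mul _) ?_
  · exact Eventually.of_forall fun r =>
      (measurable_kernelField r).aestronglyMeasurable.inner hG.aestronglyMeasurable
  · filter_upwards [lt_mem_nhds (half_lt_self hs)] with r hr
    refine Eventually.of_forall fun y => (norm_inner_le_norm _ _).trans ?_
    gcongr
    refine (norm_kernelField_le ((half_pos hs).trans hr) y).trans ?_
    gcongr
  · filter_upwards [hμ.ae_le (ae_norm_ne s)] with y hy
    have : (fun r => ⟪kernelField r y, G y⟫) =ᶠ[nhds s] fun _ => ⟪kernelField s y, G y⟫ := by
      rcases lt_or_gt_of_ne hy with h | h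
      · filter_upwards [lt_mem_nhds h] with r hr
        simp [kernelField, hr.not_gt, h.not_gt]
      · filter_upwards [gt_mem_nhds h] with r hr
        simp [kernelField, hr, h]
    exact continuousAt_const.congr this.symm

section

variable {φ : ℕ → E 2 → ℝ} {G : E 2 → E 2}

lemma aestronglyMeasurable_of_gradient_tendsto (hφ : ∀ k, IsTestFun 2 (φ k))
    (hi : ∀ k, IntegrableOn (fun x => ‖gradient (φ k) x - G x‖ ^ 2) (Metric.ball (0 : E 2) 1))
    (h : Tendsto (fun k => ∫ x in Metric.ball (0 : E 2) 1, ‖gradient (φ k) x - G x‖ ^ 2)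
      atTop (nhds 0)) :
    AEStronglyMeasurable G (volume.restrict (Metric.ball (0 : E 2) 1)) := by
  obtain ⟨ns, -, hns⟩ := exists_subseq_ae_tendsto_zero hi (fun _ _ => by positivity) h
  refine aestronglyMeasurable_of_tendsto_ae atTop
    (fun k => (continuous_gradient (hφ (ns k))).aestronglyMeasurable) ?_
  filter_upwards [hns] with x hx
  rw [tendsto_iff_norm_sub_tendsto_zero]
  simpa [Real.sqrt_sq] using hx.sqrt

lemma integrable_gradient_sub (hφ : ∀ k, IsTestFun 2 (φ k))
    (hG : AEStronglyMeasurable G (volume.restrict (Metric.ball (0 : E 2) 1)))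
    (hi : ∀ k, IntegrableOn (fun x => ‖gradient (φ k) x - G x‖ ^ 2) (Metric.ball (0 : E 2) 1))
    (k : ℕ) : IntegrableOn (fun x => gradient (φ k) x - G x) (Metric.ball (0 : E 2) 1) := by
  have hm : AEStronglyMeasurable (fun x => gradient (φ k) x - G x)
      (volume.restrict (Metric.ball (0 : E 2) 1)) :=
    (continuous_gradient (hφ k)).aestronglyMeasurable.sub hG
  exact ((memLp_two_iff_integrable_sq_norm hm).2 (hi k)).integrable (by norm_num)

lemma integrableOn_of_gradient_tendsto (hφ : ∀ k, IsTestFun 2 (φ k))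
    (hi : ∀ k, IntegrableOn (fun x => ‖gradient (φ k) x - G x‖ ^ 2) (Metric.ball (0 : E 2) 1))
    (h : Tendsto (fun k => ∫ x in Metric.ball (0 : E 2) 1, ‖gradient (φ k) x - G x‖ ^ 2)
      atTop (nhds 0)) : IntegrableOn G (Metric.ball (0 : E 2) 1) := by
  have hG := aestronglyMeasurable_of_gradient_tendsto hφ hi h
  have hGi := (integrableOn_gradient (hφ 0)).sub (integrable_gradient_sub hφ hG hi 0)
  convert! hGi using 1
  ext1 x
  simp

lemma tendsto_integral_inner_kernelField (hφ : ∀ k, IsTestFun 2 (φ k))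
    (hi : ∀ k, IntegrableOn (fun x => ‖gradient (φ k) x - G x‖ ^ 2) (Metric.ball (0 : E 2) 1))
    (h : Tendsto (fun k => ∫ x in Metric.ball (0 : E 2) 1, ‖gradient (φ k) x - G x‖ ^ 2)
      atTop (nhds 0)) {s : ℝ} (hs : 0 < s) :
    Tendsto (fun k => ∫ y in Metric.ball (0 : E 2) 1, ⟪kernelField s y, gradient (φ k) y⟫) atTop
      (nhds (∫ y in Metric.ball (0 : E 2) 1, ⟪kernelField s y, G y⟫)) := by
  have hG := aestronglyMeasurable_of_gradient_tendsto hφ hi h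
  have hd := integrable_gradient_sub hφ hG hi
  have hL := tendsto_integral_of_tendsto_integral_sq (fun k => (hd k).norm.aestronglyMeasurable)
    (fun _ _ => norm_nonneg _) hi h
  have hGi := integrableOn_of_gradient_tendsto hφ hi h
  rw [tendsto_iff_norm_sub_tendsto_zero]
  have hL' := hL.const_mul (1 / (2 * Real.pi * s))
  rw [mul_zero] at hL'
  refine squeeze_zero (fun _ => norm_nonneg _) (fun k => ?_) hL'
  rw [← integral_sub (integrable_inner_kernelField (integrableOn_gradient (hφ k)) hs)
    (integrable_inner_kernelField hGi hs), ← integral_const_mul]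
  refine norm_integral_le_of_norm_le ((hd k).norm.const_mul _) (Eventually.of_forall fun y => ?_)
  rw [← inner_sub_right]
  refine (norm_inner_le_norm _ _).trans ?_
  gcongr
  exact norm_kernelField_le hs y

end

lemma MemW.integral_inner_kernelField {v : E 2 → ℝ} {G : E 2 → E 2} (hv : MemW 2 v G)
    {u : ℝ → ℝ} (hu : MemH2 u)
    (hvu : ∀ᵐ x ∂(volume.restrict (Metric.ball (0 : E 2) 1)), v x = u ‖x‖)
    {t : E 2} (ht : t ∈ Metric.ball (0 : E 2) 1) (ht0 : t ≠ 0) :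
    ∫ y in Metric.ball (0 : E 2) 1, ⟪kernelField ‖t‖ y, G y⟫ = u ‖t‖ := by
  obtain ⟨φ, hφ, hi, hiv, h, hv⟩ := hv
  have hGi := integrableOn_of_gradient_tendsto (fun k => (hφ k).1) hi h
  obtain ⟨ns, hmono, hns⟩ := exists_subseq_ae_tendsto_zero hiv (fun _ _ => by positivity) hv
  have hae : ∀ᵐ x ∂(volume.restrict (Metric.ball (0 : E 2) 1)), x ≠ 0 →
      ∫ y in Metric.ball (0 : E 2) 1, ⟪kernelField ‖x‖ y, G y⟫ = u ‖x‖ := by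
    filter_upwards [hns, hvu] with x hx hxu hx0
    have h1 : Tendsto (fun k => φ (ns k) x) atTop (nhds (u ‖x‖)) := by
      rw [tendsto_iff_norm_sub_tendsto_zero, ← hxu]
      simpa [Real.sqrt_sq_eq_abs] using hx.sqrt
    have h2 := (tendsto_integral_inner_kernelField (fun k => (hφ k).1) hi h
      (norm_pos_iff.2 hx0)).comp hmono.tendsto_atTop
    refine tendsto_nhds_unique h2 (h1.congr fun k => ?_)
    exact (integral_kernelField_gradient (hφ (ns k)).1 (hφ (ns k)).2 hx0).symm
  have hU : IsOpen (Metric.ball (0 : E 2) 1 ∩ {0}ᶜ) :=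
    Metric.isOpen_ball.inter isOpen_compl_singleton
  refine Measure.eqOn_open_of_ae_eq (μ := (volume : Measure (E 2)))
    (f := fun x => ∫ y in Metric.ball (0 : E 2) 1, ⟪kernelField ‖x‖ y, G y⟫)
    (g := fun x => u ‖x‖) ?_ hU ?_ ?_ ⟨ht, ht0⟩
  · filter_upwards [ae_restrict_of_ae_restrict_of_subset inter_subset_left hae,
      ae_restrict_mem hU.measurableSet] with x hx hxU
    exact hx hxU.2
  · intro x hx
    have := continuousAt_integral_inner_kernelField Measure.restrict_le_self.absolutelyContinuous hGi
      (norm_pos_iff.2 hx.2)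
    exact (this.comp (f := fun x : E 2 => ‖x‖) continuous_norm.continuousAt).continuousWithinAt
  · refine hu.continuousOn.comp continuous_norm.continuousOn fun x hx => ?_
    exact ⟨norm_pos_iff.2 hx.2, mem_ball_zero_iff.1 hx.1⟩

/-- Minus the derivative of the profile `q ↦ gammaTM s (√q)`, where `a = s ^ 2`. -/
noncomputable def kernelDensity (a q : ℝ) : ℝ := if a < q then 1 / (4 * Real.pi * q) else 0

lemma kernelDensity_nonneg {a : ℝ} (ha : 0 < a) (q : ℝ) : 0 ≤ kernelDensity a q := by
  have hpi := Real.pi_pos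
  unfold kernelDensity
  split_ifs with h
  · have := ha.trans h
    positivity
  · rfl

lemma kernelDensity_le {a : ℝ} (ha : 0 < a) (q : ℝ) :
    kernelDensity a q ≤ 1 / (4 * Real.pi * a) := by
  have hpi := Real.pi_pos
  unfold kernelDensity
  split_ifs with h
  · gcongr
  · positivity

lemma measurable_kernelDensity (a : ℝ) : Measurable (kernelDensity a) := by
  refine Measurable.ite measurableSet_Ioi ?_ measurable_const
  fun_prop

lemma intervalIntegrable_kernelDensity {a : ℝ} (ha : 0 < a) (b c : ℝ) :
    IntervalIntegrable (kernelDensity a) volume b c := by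
  refine (intervalIntegrable_const (c := 1 / (4 * Real.pi * a))).mono_fun
    (measurable_kernelDensity a).aestronglyMeasurable (Eventually.of_forall fun q => ?_)
  have h := kernelDensity_le ha q
  have h0 := kernelDensity_nonneg ha q
  simpa only [Real.norm_of_nonneg h0, Real.norm_of_nonneg (h0.trans h)] using h

lemma integral_kernelDensity {a q : ℝ} (ha : 0 < a) (haq : a ≤ q) (hq : q ≤ 1) :
    ∫ s in q..1, kernelDensity a s = 1 / (4 * Real.pi) * Real.log (1 / q) := by
  have hpi := Real.pi_pos
  rw [← integral_one_div_of_pos (ha.trans_le haq) one_pos, ← intervalIntegral.integral_const_mul]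
  refine intervalIntegral.integral_congr_ae (Eventually.of_forall fun s hs => ?_)
  rw [uIoc_of_le hq] at hs
  rw [kernelDensity, if_pos (haq.trans_lt hs.1)]
  field_simp

lemma gammaTM_eq_integral {s r : ℝ} (hs : 0 < s) (hs1 : s < 1) (hr : 0 < r) (hr1 : r ≤ 1) :
    gammaTM s r = ∫ q in r ^ 2..1, kernelDensity (s ^ 2) q := by
  have hpi := Real.pi_pos
  have hlog : ∀ x : ℝ, 1 / (4 * Real.pi) * Real.log (1 / x ^ 2) =
      1 / (2 * Real.pi) * Real.log (1 / x) := by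
    intro x
    simp only [one_div, Real.log_inv, Real.log_pow]
    push_cast
    field_simp
    ring
  have hs2 : s ^ 2 ≤ 1 := pow_le_one₀ hs.le hs1.le
  have hr2 : r ^ 2 ≤ 1 := pow_le_one₀ hr.le hr1
  have ha : 0 < s ^ 2 := by positivity
  rcases le_total s r with h | h
  · rw [integral_kernelDensity ha (by gcongr) hr2, hlog, gammaTM, min_eq_left]
    simp only [one_div, Real.log_inv, neg_le_neg_iff]
    exact Real.log_le_log hs h
  · rw [← intervalIntegral.integral_add_adjacent_intervals
      (intervalIntegrable_kernelDensity ha _ (s ^ 2)) (intervalIntegrable_kernelDensity ha _ _),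
      integral_kernelDensity ha le_rfl hs2, hlog, gammaTM, min_eq_right,
      intervalIntegral.integral_zero_ae, zero_add]
    · refine Eventually.of_forall fun q hq => ?_
      rw [uIoc_of_le (by gcongr)] at hq
      exact if_neg hq.2.not_gt
    · simp only [one_div, Real.log_inv, neg_le_neg_iff]
      exact Real.log_le_log hr h

/-- Smooth bumps exhausting the interval `(a, 1)` from inside. -/
noncomputable def intervalBump {a : ℝ} (ha1 : a < 1) (k : ℕ) : ContDiffBump ((1 + a) / 2) where
  rIn := (1 - a) / 2 * (1 - 1 / ((k : ℝ) + 2))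
  rOut := (1 - a) / 2 * (1 - 1 / ((k : ℝ) + 3))
  rIn_pos := by
    have : 1 / ((k : ℝ) + 2) < 1 := by
      rw [div_lt_one (by positivity)]
      linarith [k.cast_nonneg (α := ℝ)]
    exact mul_pos (by linarith) (by linarith)
  rIn_lt_rOut := by
    have : 0 < (1 - a) / 2 := by linarith
    gcongr
    norm_num

section

variable {a : ℝ} (ha1 : a < 1)

lemma rOut_intervalBump_lt (k : ℕ) : (intervalBump ha1 k).rOut < (1 - a) / 2 := by
  have h : 0 < 1 / ((k : ℝ) + 3) := by positivity
  have h2 : 0 < (1 - a) / 2 := by linarith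
  show (1 - a) / 2 * (1 - 1 / ((k : ℝ) + 3)) < (1 - a) / 2
  nlinarith

lemma intervalBump_eq_zero_of_le (k : ℕ) {q : ℝ}
    (hq : q ≤ (1 + a) / 2 - (intervalBump ha1 k).rOut) : intervalBump ha1 k q = 0 := by
  refine (intervalBump ha1 k).zero_of_le_dist ?_
  rw [dist_comm, Real.dist_eq]
  exact le_trans (by linarith) (le_abs_self _)

lemma intervalBump_eq_zero_of_ge (k : ℕ) {q : ℝ}
    (hq : (1 + a) / 2 + (intervalBump ha1 k).rOut ≤ q) : intervalBump ha1 k q = 0 := by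
  refine (intervalBump ha1 k).zero_of_le_dist ?_
  rw [Real.dist_eq]
  exact le_trans (by linarith) (le_abs_self _)

lemma abs_intervalBump_sub_one_le (k : ℕ) (q : ℝ) : |intervalBump ha1 k q - 1| ≤ 1 := by
  rw [abs_le]
  constructor <;> linarith [(intervalBump ha1 k).nonneg (x := q),
    (intervalBump ha1 k).le_one (x := q)]

lemma eventually_intervalBump_eq_one {q : ℝ} (hq : q ∈ Ioo a 1) :
    ∀ᶠ k in atTop, intervalBump ha1 k q = 1 := by
  have h1 : Tendsto (fun k : ℕ => (1 - a) / 2 * (1 - 1 / ((k : ℝ) + 2))) atTop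
      (nhds ((1 - a) / 2 * (1 - 0))) := by
    refine (tendsto_const_nhds.sub ?_).const_mul _
    simp only [one_div]
    exact tendsto_inv_atTop_zero.comp
      (tendsto_atTop_add_const_right _ _ tendsto_natCast_atTop_atTop)
  have h2 : dist q ((1 + a) / 2) < (1 - a) / 2 * (1 - 0) := by
    rw [Real.dist_eq, abs_lt]
    constructor <;> linarith [hq.1, hq.2]
  filter_upwards [h1.eventually_const_lt h2] with k hk
  exact (intervalBump ha1 k).one_of_mem_closedBall hk.le

lemma contDiff_intervalBump_mul_kernelDensity (ha : 0 < a) (k : ℕ) :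
    ContDiff ℝ (⊤ : ℕ∞) fun q => intervalBump ha1 k q * kernelDensity a q := by
  have hpi := Real.pi_pos
  have hr := rOut_intervalBump_lt ha1 k
  rw [contDiff_iff_contDiffAt]
  intro q
  rcases le_or_gt q a with h | h
  · have : (fun q => intervalBump ha1 k q * kernelDensity a q) =ᶠ[nhds q] fun _ => 0 := by
      filter_upwards [gt_mem_nhds (show q < (1 + a) / 2 - (intervalBump ha1 k).rOut by linarith)]
        with p hp
      rw [intervalBump_eq_zero_of_le ha1 k hp.le, zero_mul]
    exact contDiffAt_const.congr_of_eventuallyEq this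
  · have : (fun q => intervalBump ha1 k q * kernelDensity a q) =ᶠ[nhds q]
        fun q => intervalBump ha1 k q * (1 / (4 * Real.pi * q)) := by
      filter_upwards [lt_mem_nhds h] with p hp
      rw [kernelDensity, if_pos hp]
    refine ContDiffAt.congr_of_eventuallyEq ?_ this
    have hq : 4 * Real.pi * q ≠ 0 := by have := ha.trans h; positivity
    exact (intervalBump ha1 k).contDiff.contDiffAt.mul
      (contDiffAt_const.div (contDiffAt_const.mul contDiffAt_id) hq)

/-- Test functions approximating the kernel `x ↦ gammaTM s ‖x‖`, where `a = s ^ 2`. -/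
noncomputable def kernelApprox (k : ℕ) (x : E 2) : ℝ :=
  ∫ q in ‖x‖ ^ 2..1, intervalBump ha1 k q * kernelDensity a q

lemma hasDerivAt_integral_intervalBump (ha : 0 < a) (k : ℕ) (p : ℝ) :
    HasDerivAt (fun p => ∫ q in p..1, intervalBump ha1 k q * kernelDensity a q)
      (-(intervalBump ha1 k p * kernelDensity a p)) p := by
  have hc := (contDiff_intervalBump_mul_kernelDensity ha1 ha k).continuous
  exact intervalIntegral.integral_hasDerivAt_left (hc.intervalIntegrable _ _)
    (hc.stronglyMeasurableAtFilter _ _) hc.continuousAt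

lemma contDiff_kernelApprox (ha : 0 < a) (k : ℕ) :
    ContDiff ℝ (⊤ : ℕ∞) (kernelApprox ha1 k) := by
  have h1 : ContDiff ℝ (⊤ : ℕ∞)
      (fun p : ℝ => ∫ q in p..1, intervalBump ha1 k q * kernelDensity a q) := by
    rw [contDiff_infty_iff_deriv]
    refine ⟨fun p => (hasDerivAt_integral_intervalBump ha1 ha k p).differentiableAt, ?_⟩
    have : deriv (fun p : ℝ => ∫ q in p..1, intervalBump ha1 k q * kernelDensity a q) =
        fun p => -(intervalBump ha1 k p * kernelDensity a p) :=
      funext fun p => (hasDerivAt_integral_intervalBump ha1 ha k p).deriv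
    rw [this]
    exact (contDiff_intervalBump_mul_kernelDensity ha1 ha k).neg
  exact h1.comp (contDiff_norm_sq ℝ)

lemma gradient_kernelApprox {s : ℝ} (hs : 0 < s) (hs1 : s ^ 2 < 1) (k : ℕ) (x : E 2) :
    gradient (kernelApprox hs1 k) x = intervalBump hs1 k (‖x‖ ^ 2) • kernelField s x := by
  have hpi := Real.pi_pos
  have h1 := (hasDerivAt_integral_intervalBump hs1 (by positivity) k (‖x‖ ^ 2)).comp_hasFDerivAt x
    (hasStrictFDerivAt_norm_sq x).hasFDerivAt
  refine HasGradientAt.gradient ?_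
  rw [hasGradientAt_iff_hasFDerivAt]
  convert! h1 using 1
  ext y
  simp only [kernelField, kernelDensity, InnerProductSpace.toDual_apply_apply, real_inner_smul_left,
    sq_lt_sq₀ hs.le (norm_nonneg x)]
  split_ifs with h
  · have hx : 0 < ‖x‖ := hs.trans h
    simp
    field_simp
    ring
  · simp

lemma isTestFun_kernelApprox (ha : 0 < a) (k : ℕ) : IsTestFun 2 (kernelApprox ha1 k) := by
  set b := (1 + a) / 2 + (intervalBump ha1 k).rOut with hb
  have hb1 : b < 1 := by linarith [rOut_intervalBump_lt ha1 k]
  have hts : tsupport (kernelApprox ha1 k) ⊆ {x : E 2 | ‖x‖ ^ 2 ≤ b} := by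
    refine closure_minimal (fun x hx => ?_) (isClosed_le (by fun_prop) continuous_const)
    by_contra h
    refine hx ?_
    simp only [mem_ofPred_eq, not_le] at h
    refine intervalIntegral.integral_zero_ae (Eventually.of_forall fun q hq => ?_)
    have : b ≤ q := (le_min h.le hb1.le).trans hq.1.le
    rw [intervalBump_eq_zero_of_ge ha1 k this, zero_mul]
  have hball : tsupport (kernelApprox ha1 k) ⊆ Metric.ball 0 1 := fun x hx => by
    have : ‖x‖ ^ 2 < 1 := (hts hx).trans_lt hb1
    rw [mem_ball_zero_iff]
    exact lt_of_pow_lt_pow_left₀ 2 zero_le_one (by simpa using this)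
  exact ⟨contDiff_kernelApprox ha1 ha k,
    (isCompact_closedBall (0 : E 2) 1).of_isClosed_subset (isClosed_tsupport _)
      (hball.trans Metric.ball_subset_closedBall), hball⟩

lemma isRadial_kernelApprox (k : ℕ) : IsRadial 2 (kernelApprox ha1 k) := fun x y h => by
  simp only [kernelApprox, h]

end

lemma integrableOn_and_tendsto_of_norm_le {f : ℕ → E 2 → ℝ} {C : ℝ}
    (hm : ∀ k, AEStronglyMeasurable (f k) (volume.restrict (Metric.ball (0 : E 2) 1)))
    (hb : ∀ k, ∀ᵐ x ∂volume.restrict (Metric.ball (0 : E 2) 1), ‖f k x‖ ≤ C)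
    (hl : ∀ᵐ x ∂volume.restrict (Metric.ball (0 : E 2) 1),
      Tendsto (fun k => f k x) atTop (nhds 0)) :
    (∀ k, IntegrableOn (fun x => f k x) (Metric.ball (0 : E 2) 1)) ∧
      Tendsto (fun k => ∫ x in Metric.ball (0 : E 2) 1, f k x) atTop (nhds 0) := by
  refine ⟨fun k => (integrable_const C).mono' (hm k) (hb k), ?_⟩
  simpa using tendsto_integral_of_dominated_convergence (fun _ => C) hm (integrable_const C) hb hl

lemma kernelApprox_sub_gammaTM {s : ℝ} (hs : 0 < s) (hs1 : s ^ 2 < 1) (k : ℕ) {x : E 2}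
    (hx : x ∈ Metric.ball (0 : E 2) 1) (hx0 : x ≠ 0) :
    kernelApprox hs1 k x - gammaTM s ‖x‖ =
      ∫ q in ‖x‖ ^ 2..1, (intervalBump hs1 k q - 1) * kernelDensity (s ^ 2) q := by
  have ha : 0 < s ^ 2 := by positivity
  have hs1' : s < 1 := lt_of_pow_lt_pow_left₀ 2 zero_le_one (by simpa using hs1)
  rw [gammaTM_eq_integral hs hs1' (norm_pos_iff.2 hx0) (mem_ball_zero_iff.1 hx).le, kernelApprox,
    ← intervalIntegral.integral_sub
      ((contDiff_intervalBump_mul_kernelDensity hs1 ha k).continuous.intervalIntegrable _ _)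
      (intervalIntegrable_kernelDensity ha _ _)]
  simp only [sub_mul, one_mul]

lemma norm_intervalBump_sub_one_mul_le {a : ℝ} (ha : 0 < a) (ha1 : a < 1) (k : ℕ) (q : ℝ) :
    ‖(intervalBump ha1 k q - 1) * kernelDensity a q‖ ≤ 1 / (4 * Real.pi * a) := by
  rw [norm_mul, Real.norm_of_nonneg (kernelDensity_nonneg ha q)]
  exact (mul_le_of_le_one_left (kernelDensity_nonneg ha q)
    (abs_intervalBump_sub_one_le ha1 k q)).trans (kernelDensity_le ha q)

lemma ae_ne_zero : ∀ᵐ x : E 2, x ≠ 0 := by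
  filter_upwards [ae_norm_ne 0] with x hx
  exact norm_ne_zero_iff.1 hx

lemma memW_gammaTM {s : ℝ} (hs : 0 < s) (hs1 : s < 1) :
    MemW 2 (fun x => gammaTM s ‖x‖) (fun x => (deriv (gammaTM s) ‖x‖ / ‖x‖) • x) := by
  have ha : 0 < s ^ 2 := by positivity
  have ha1 : s ^ 2 < 1 := pow_lt_one₀ hs.le hs1 two_ne_zero
  have hball : ∀ᵐ x ∂volume.restrict (Metric.ball (0 : E 2) 1), x ∈ Metric.ball (0 : E 2) 1 :=
    ae_restrict_mem Metric.isOpen_ball.measurableSet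
  have hne : ∀ᵐ x ∂volume.restrict (Metric.ball (0 : E 2) 1), x ≠ 0 := ae_restrict_of_ae ae_ne_zero
  have hns : ∀ᵐ x ∂volume.restrict (Metric.ball (0 : E 2) 1), ‖x‖ ≠ s :=
    ae_restrict_of_ae (ae_norm_ne s)
  have hφ := isTestFun_kernelApprox ha1 ha
  have hgrad := integrableOn_and_tendsto_of_norm_le (C := (1 / (2 * Real.pi * s)) ^ 2)
    (f := fun k x => ‖gradient (kernelApprox ha1 k) x - (deriv (gammaTM s) ‖x‖ / ‖x‖) • x‖ ^ 2)
    (fun k => by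
      have h1 : Measurable fun x : E 2 => (deriv (gammaTM s) ‖x‖ / ‖x‖) • x :=
        (((measurable_deriv _).comp measurable_norm).div measurable_norm).smul measurable_id
      exact (((continuous_gradient (hφ k)).measurable.sub h1).norm.pow_const 2).aestronglyMeasurable)
    (fun k => by
      filter_upwards [hns] with x hx
      rw [deriv_gammaTM_smul_eq_kernelField hs hx, gradient_kernelApprox hs, Real.norm_of_nonneg
        (by positivity)]
      have : intervalBump ha1 k (‖x‖ ^ 2) • kernelField s x - kernelField s x =
        (intervalBump ha1 k (‖x‖ ^ 2) - 1) • kernelField s x := by rw [sub_smul, one_smul]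
      rw [this, norm_smul]
      gcongr
      exact (mul_le_of_le_one_left (norm_nonneg _) (abs_intervalBump_sub_one_le ha1 k _)).trans
        (norm_kernelField_le hs x))
    (by
      filter_upwards [hns, hball] with x hx hxb
      refine tendsto_const_nhds.congr' ?_
      rcases lt_or_gt_of_ne hx with h | h
      · refine Eventually.of_forall fun k => ?_
        simp only [deriv_gammaTM_smul_eq_kernelField hs hx, gradient_kernelApprox hs, kernelField,
          if_neg h.not_gt]
        simp
      · filter_upwards [eventually_intervalBump_eq_one ha1 (q := ‖x‖ ^ 2)
          ⟨by gcongr, pow_lt_one₀ (norm_nonneg x) (mem_ball_zero_iff.1 hxb) two_ne_zero⟩] with k hk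
        simp only [deriv_gammaTM_smul_eq_kernelField hs hx, gradient_kernelApprox hs, hk]
        simp)
  have hval := integrableOn_and_tendsto_of_norm_le (C := (1 / (4 * Real.pi * s ^ 2)) ^ 2)
    (f := fun k x => (kernelApprox ha1 k x - gammaTM s ‖x‖) ^ 2)
    (fun k => by
      have h1 : Measurable fun x : E 2 => gammaTM s ‖x‖ := by
        unfold gammaTM
        fun_prop
      exact (((hφ k).1.continuous.measurable.sub h1).pow_const 2).aestronglyMeasurable)
    (fun k => by
      filter_upwards [hball, hne] with x hx hx0
      rw [kernelApprox_sub_gammaTM hs ha1 k hx hx0, norm_pow]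
      gcongr
      refine (intervalIntegral.norm_integral_le_of_norm_le_const
        fun q _ => norm_intervalBump_sub_one_mul_le ha ha1 k q).trans ?_
      have hx1 : ‖x‖ ^ 2 ≤ 1 := pow_le_one₀ (norm_nonneg x) (mem_ball_zero_iff.1 hx).le
      refine mul_le_of_le_one_right (by have := Real.pi_pos; positivity) ?_
      rw [abs_of_nonneg (by linarith)]
      linarith [sq_nonneg ‖x‖])
    (by
      filter_upwards [hball, hne] with x hx hx0
      have hx1 : ‖x‖ ^ 2 ≤ 1 := pow_le_one₀ (norm_nonneg x) (mem_ball_zero_iff.1 hx).le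
      simp only [kernelApprox_sub_gammaTM hs ha1 _ hx hx0]
      have h := intervalIntegral.tendsto_integral_filter_of_dominated_convergence
        (μ := volume) (a := ‖x‖ ^ 2) (b := 1) (l := atTop) (f := fun _ => (0 : ℝ))
        (F := fun k q => (intervalBump ha1 k q - 1) * kernelDensity (s ^ 2) q)
        (fun _ => 1 / (4 * Real.pi * s ^ 2))
        (Eventually.of_forall fun k => (((intervalBump ha1 k).continuous.measurable.sub_const 1).mul
          (measurable_kernelDensity _)).aestronglyMeasurable)
        (Eventually.of_forall fun k => Eventually.of_forall fun q _ =>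
          norm_intervalBump_sub_one_mul_le ha ha1 k q)
        intervalIntegrable_const
        (by
          filter_upwards [Measure.ae_ne volume (1 : ℝ)] with q hq1 hq
          rw [uIoc_of_le hx1] at hq
          refine tendsto_const_nhds.congr' ?_
          rcases le_or_gt q (s ^ 2) with h | h
          · refine Eventually.of_forall fun k => ?_
            simp [kernelDensity, h.not_gt]
          · filter_upwards [eventually_intervalBump_eq_one ha1 ⟨h, lt_of_le_of_ne hq.2 hq1⟩] with k hk
            simp [hk])
      simpa using h.pow 2)
  exact ⟨kernelApprox ha1, fun k => ⟨hφ k, isRadial_kernelApprox ha1 k⟩, hgrad.1, hval.1, hgrad.2,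
    hval.2⟩

/-- For every `t ∈ B₂` with `t ≠ 0`, the function `k_t(x) = γ_{|t|}(|x|)`
belongs to `W^{1,2}_{0,r}(B₂)` (with weak gradient `γ_{|t|}'(|x|)·x/|x|`) and is the
reproducing kernel for the point `t`: for every `v ∈ W^{1,2}_{0,r}(B₂)` with locally
absolutely continuous radial representative `u ∈ H₂` (so `v(x) = u(|x|)` a.e.),
`∫_{B₂} ∇k_t · ∇v dx = u(|t|)`. -/
theorem kernel_reproduces_W (t : E 2) (ht : t ∈ Metric.ball (0 : E 2) 1) (ht0 : t ≠ 0) :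
    MemW 2 (fun x => gammaTM ‖t‖ ‖x‖)
      (fun x => (deriv (gammaTM ‖t‖) ‖x‖ / ‖x‖) • x) ∧
    ∀ (v : E 2 → ℝ) (G : E 2 → E 2), MemW 2 v G →
      ∀ u : ℝ → ℝ, MemH2 u →
        (∀ᵐ x ∂(volume.restrict (Metric.ball (0 : E 2) 1)), v x = u ‖x‖) →
        ∫ x in Metric.ball (0 : E 2) 1,
          ⟪(deriv (gammaTM ‖t‖) ‖x‖ / ‖x‖) • x, G x⟫ = u ‖t‖ := by
  have h0 : 0 < ‖t‖ := norm_pos_iff.2 ht0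
  refine ⟨memW_gammaTM h0 (mem_ball_zero_iff.1 ht), fun v G hv u hu hvu => ?_⟩
  rw [← hv.integral_inner_kernelField hu hvu ht ht0]
  refine integral_congr_ae (ae_restrict_of_ae ?_)
  filter_upwards [ae_norm_ne ‖t‖] with x hx
  rw [deriv_gammaTM_smul_eq_kernelField h0 hx]
end
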